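/- Let F, G : ℝ³ → ℝ be smooth, let D_F, D_G ⊆ ℝ³ be open sets on which F (respectively G) and G satisfy: the functions H, H_{u₁}, H_{u₁u₁} and u₁·H_{u₁} − H are nonvanishing (for H = F on D_F, H = G on D_G), and suppose smooth functions K_F : D_F → ℝ, K_G : D_G → ℝ satisfy [∇₃^F, ∇₁^F] = K_F·∇₂^F and [∇₃^G, ∇₁^G] = K_G·∇₂^G. Suppose the feedback transformation (X,U) relates G to F on D_G and its prolongation Φ̃ is a diffeomorphism from D_G onto D_F. Then σ_F ∘ Φ̃ = σ_G on D_G, and consequently the images coincide: Σ_F := σ_F(D_F) = σ_G(D_G) =: Σ_G. That is, the 3-dimensional image Σ_F ⊆ ℝ¹⁴ depends only on the feedback equivalence class of F. -/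

import Mathlib

noncomputable section

/-- Directional (partial) derivative of a function on `ℝ³ = ℝ × ℝ × ℝ`
(coordinates `(x, u, u₁)`) in the direction `v`. -/
def pd (H : ℝ × ℝ × ℝ → ℝ) (v : ℝ × ℝ × ℝ) : ℝ × ℝ × ℝ → ℝ :=
  fun p => fderiv ℝ H p v

/-- The coordinate direction `∂/∂x`. -/
def dx : ℝ × ℝ × ℝ := (1, 0, 0)

/-- The coordinate direction `∂/∂u`. -/
def du : ℝ × ℝ × ℝ := (0, 1, 0)

/-- The coordinate direction `∂/∂u₁`. -/
def du1 : ℝ × ℝ × ℝ := (0, 0, 1)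

/-- `U_x`, the partial derivative of `U(x,u)` in the first variable. -/
def Ux (U : ℝ × ℝ → ℝ) : ℝ × ℝ → ℝ := fun q => fderiv ℝ U q (1, 0)

/-- `U_u`, the partial derivative of `U(x,u)` in the second variable. -/
def Uu (U : ℝ × ℝ → ℝ) : ℝ × ℝ → ℝ := fun q => fderiv ℝ U q (0, 1)

/-- The feedback transformation `(X, U)` relates `G` to `F` on `D`:
`X'(x)·G(x,u,u₁) = F(X x, U (x,u), U_x·G + U_u·u₁)` for all `(x,u,u₁) ∈ D`. -/
def Relates (X : ℝ → ℝ) (U : ℝ × ℝ → ℝ) (G F : ℝ × ℝ × ℝ → ℝ) (D : Set (ℝ × ℝ × ℝ)) : Prop :=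
  ∀ p ∈ D, deriv X p.1 * G p =
    F (X p.1, U (p.1, p.2.1), Ux U (p.1, p.2.1) * G p + Uu U (p.1, p.2.1) * p.2.2)

/-- The prolongation `Φ̃(x,u,u₁) = (X x, U (x,u), U_x·G + U_u·u₁)`. -/
def Prol (X : ℝ → ℝ) (U : ℝ × ℝ → ℝ) (G : ℝ × ℝ × ℝ → ℝ) : ℝ × ℝ × ℝ → ℝ × ℝ × ℝ :=
  fun p => (X p.1, U (p.1, p.2.1), Ux U (p.1, p.2.1) * G p + Uu U (p.1, p.2.1) * p.2.2)

/-- `W(x,u,u₁) = U_x(x,u)·G_{u₁}(x,u,u₁) + U_u(x,u)`. -/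
def Wfun (U : ℝ × ℝ → ℝ) (G : ℝ × ℝ × ℝ → ℝ) : ℝ × ℝ × ℝ → ℝ :=
  fun p => Ux U (p.1, p.2.1) * pd G du1 p + Uu U (p.1, p.2.1)

/-- The basic second-order feedback differential invariant
`J^H = H²·H_{u₁u₁} / ((u₁·H_{u₁} − H)·H_{u₁}²)`. -/
def Jinv (H : ℝ × ℝ × ℝ → ℝ) : ℝ × ℝ × ℝ → ℝ :=
  fun p => H p ^ 2 * pd (pd H du1) du1 p / ((p.2.2 * pd H du1 p - H p) * pd H du1 p ^ 2)

/-- The feedback invariant derivation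
`∇₁^H = (0, (u₁·H_{u₁} − H)/H_{u₁}, (H − u₁·H_{u₁})·H_u/H_{u₁}²)`. -/
def nabla1 (H : ℝ × ℝ × ℝ → ℝ) : ℝ × ℝ × ℝ → ℝ × ℝ × ℝ := fun p =>
  (0, (p.2.2 * pd H du1 p - H p) / pd H du1 p,
    (H p - p.2.2 * pd H du1 p) * pd H du p / pd H du1 p ^ 2)

/-- The feedback invariant derivation `∇₂^H = (0, 0, H/H_{u₁})`. -/
def nabla2 (H : ℝ × ℝ × ℝ → ℝ) : ℝ × ℝ × ℝ → ℝ × ℝ × ℝ := fun p =>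
  (0, 0, H p / pd H du1 p)

/-- The feedback invariant derivation
`∇₃^H = (H, H/H_{u₁}, (H_x H_{u₁} + H_u − u₁ H_{uu₁} − H_{xu₁})/H_{u₁u₁}
          + ((u₁ H_{u₁} − H)/H_{u₁}²)·H_u)`. -/
def nabla3 (H : ℝ × ℝ × ℝ → ℝ) : ℝ × ℝ × ℝ → ℝ × ℝ × ℝ := fun p =>
  (H p, H p / pd H du1 p,
    (pd H dx p * pd H du1 p + pd H du p - p.2.2 * pd (pd H du) du1 p - pd (pd H dx) du1 p)
        / pd (pd H du1) du1 p
      + ((p.2.2 * pd H du1 p - H p) / pd H du1 p ^ 2) * pd H du p)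

/-- Lie bracket of vector fields on (an open subset of) `ℝ³`:
`[V,W](p) = DW(p)·V(p) − DV(p)·W(p)`. -/
def lie (V W : ℝ × ℝ × ℝ → ℝ × ℝ × ℝ) : ℝ × ℝ × ℝ → ℝ × ℝ × ℝ :=
  fun p => fderiv ℝ W p (V p) - fderiv ℝ V p (W p)

/-- The action of a vector field `V` on a function `I`: `(V I)(p) = DI(p)·V(p)`. -/
def vfD (V : ℝ × ℝ × ℝ → ℝ × ℝ × ℝ) (I : ℝ × ℝ × ℝ → ℝ) : ℝ × ℝ × ℝ → ℝ :=
  fun p => fderiv ℝ I p (V p)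

/-- The invariants map `σ_H : ℝ³ → ℝ¹⁴` built from the basic invariants `J^H`
and `K_H` and the invariant derivations `∇₁^H, ∇₂^H, ∇₃^H`. -/
def sigmaMap (H K : ℝ × ℝ × ℝ → ℝ) : ℝ × ℝ × ℝ → (Fin 14 → ℝ) := fun p =>
  ![Jinv H p,
    vfD (nabla1 H) (Jinv H) p, vfD (nabla2 H) (Jinv H) p, vfD (nabla3 H) (Jinv H) p,
    vfD (nabla1 H) (vfD (nabla1 H) (Jinv H)) p,
    vfD (nabla1 H) (vfD (nabla2 H) (Jinv H)) p,
    vfD (nabla1 H) (vfD (nabla3 H) (Jinv H)) p,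
    vfD (nabla2 H) (vfD (nabla2 H) (Jinv H)) p,
    vfD (nabla2 H) (vfD (nabla3 H) (Jinv H)) p,
    vfD (nabla3 H) (vfD (nabla3 H) (Jinv H)) p,
    K p, vfD (nabla1 H) K p, vfD (nabla2 H) K p, vfD (nabla3 H) K p]

open scoped ContDiff

lemma fderiv_eq_pd (H : ℝ × ℝ × ℝ → ℝ) (p v : ℝ × ℝ × ℝ) :
    fderiv ℝ H p v = v.1 * pd H dx p + v.2.1 * pd H du p + v.2.2 * pd H du1 p := by
  have hv : v = v.1 • dx + v.2.1 • du + v.2.2 • du1 := by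
    ext <;> simp [dx, du, du1]
  conv_lhs => rw [hv]
  simp [pd]

lemma contDiff_fderiv_apply_const {E : Type*} [NormedAddCommGroup E] [NormedSpace ℝ E]
    {f : E → ℝ} (hf : ContDiff ℝ ∞ f) (v : E) : ContDiff ℝ ∞ (fun p => fderiv ℝ f p v) :=
  (hf.fderiv_right (m := ∞) le_rfl).clm_apply contDiff_const

lemma contDiff_pd {H : ℝ × ℝ × ℝ → ℝ} (hH : ContDiff ℝ ∞ H) (v : ℝ × ℝ × ℝ) :
    ContDiff ℝ ∞ (pd H v) :=
  contDiff_fderiv_apply_const hH v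

lemma fderiv_fderiv_apply_comm {E : Type*} [NormedAddCommGroup E] [NormedSpace ℝ E]
    {f : E → ℝ} (hf : ContDiff ℝ ∞ f) (p v w : E) :
    fderiv ℝ (fun q => fderiv ℝ f q v) p w = fderiv ℝ (fun q => fderiv ℝ f q w) p v := by
  have hd : DifferentiableAt ℝ (fderiv ℝ f) p :=
    ((hf.fderiv_right (m := ∞) le_rfl).differentiable (by simp)).differentiableAt
  have hs : IsSymmSndFDerivAt ℝ f p :=
    hf.contDiffAt.isSymmSndFDerivAt (by simpa using WithTop.coe_le_coe.2 (le_top : (2 : ℕ∞) ≤ ⊤))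
  have h (a b : E) : fderiv ℝ (fun q => fderiv ℝ f q a) p b = fderiv ℝ (fderiv ℝ f) p b a := by
    rw [fderiv_clm_apply hd (differentiableAt_const a)]
    simp
  rw [h, h]
  exact hs.eq w v

lemma pd_comm {H : ℝ × ℝ × ℝ → ℝ} (hH : ContDiff ℝ ∞ H) (v w p : ℝ × ℝ × ℝ) :
    pd (pd H v) w p = pd (pd H w) v p :=
  fderiv_fderiv_apply_comm hH p v w

section Smoothness

variable {H : ℝ × ℝ × ℝ → ℝ} {D : Set (ℝ × ℝ × ℝ)}

lemma contDiffOn_Jinv (hH : ContDiff ℝ ∞ H)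
    (h1 : ∀ p ∈ D, pd H du1 p ≠ 0) (h3 : ∀ p ∈ D, p.2.2 * pd H du1 p - H p ≠ 0) :
    ContDiffOn ℝ ∞ (Jinv H) D := by
  have c1 := contDiff_pd hH du1
  have c11 := contDiff_pd c1 du1
  refine ContDiffOn.div (by fun_prop) (by fun_prop) fun p hp => ?_
  exact mul_ne_zero (h3 p hp) (pow_ne_zero _ (h1 p hp))

lemma contDiffOn_nabla1 (hH : ContDiff ℝ ∞ H) (h1 : ∀ p ∈ D, pd H du1 p ≠ 0) :
    ContDiffOn ℝ ∞ (nabla1 H) D := by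
  have c1 := contDiff_pd hH du1
  have cu := contDiff_pd hH du
  refine contDiffOn_const.prodMk (ContDiffOn.prodMk ?_ ?_)
  · exact ContDiffOn.div (by fun_prop) (by fun_prop) h1
  · exact ContDiffOn.div (by fun_prop) (by fun_prop) fun p hp => pow_ne_zero _ (h1 p hp)

lemma contDiffOn_nabla2 (hH : ContDiff ℝ ∞ H) (h1 : ∀ p ∈ D, pd H du1 p ≠ 0) :
    ContDiffOn ℝ ∞ (nabla2 H) D := by
  have c1 := contDiff_pd hH du1
  exact contDiffOn_const.prodMk (contDiffOn_const.prodMk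
    (ContDiffOn.div (by fun_prop) (by fun_prop) h1))

lemma contDiffOn_nabla3 (hH : ContDiff ℝ ∞ H) (h1 : ∀ p ∈ D, pd H du1 p ≠ 0)
    (h2 : ∀ p ∈ D, pd (pd H du1) du1 p ≠ 0) : ContDiffOn ℝ ∞ (nabla3 H) D := by
  have c1 := contDiff_pd hH du1
  have cu := contDiff_pd hH du
  have cx := contDiff_pd hH dx
  have c11 := contDiff_pd c1 du1
  have cu1 := contDiff_pd cu du1
  have cx1 := contDiff_pd cx du1
  refine hH.contDiffOn.prodMk (ContDiffOn.prodMk ?_ (ContDiffOn.add ?_ (ContDiffOn.mul ?_ ?_)))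
  · exact ContDiffOn.div (by fun_prop) (by fun_prop) h1
  · exact ContDiffOn.div (by fun_prop) (by fun_prop) h2
  · exact ContDiffOn.div (by fun_prop) (by fun_prop) fun p hp => pow_ne_zero _ (h1 p hp)
  · exact cu.contDiffOn

lemma contDiffOn_vfD (hD : IsOpen D) {V : ℝ × ℝ × ℝ → ℝ × ℝ × ℝ} {I : ℝ × ℝ × ℝ → ℝ}
    (hV : ContDiffOn ℝ ∞ V D) (hI : ContDiffOn ℝ ∞ I D) : ContDiffOn ℝ ∞ (vfD V I) D :=
  (hI.fderiv_of_isOpen hD (m := ∞) le_rfl).clm_apply hV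

lemma ContDiffOn.differentiableAt_of_isOpen {E : Type*} [NormedAddCommGroup E] [NormedSpace ℝ E]
    {f : ℝ × ℝ × ℝ → E} (hD : IsOpen D) (hf : ContDiffOn ℝ ∞ f D) {p : ℝ × ℝ × ℝ} (hp : p ∈ D) :
    DifferentiableAt ℝ f p :=
  (hf.contDiffAt (hD.mem_nhds hp)).differentiableAt (by simp)

end Smoothness

/-- The `u`-component of `[∇₃, ∇₁] = K ∇₂` forces `(H - 1) H_{xu₁} = 0`. -/
lemma sub_one_mul_pd_eq_zero {H K : ℝ × ℝ × ℝ → ℝ} {D : Set (ℝ × ℝ × ℝ)} (hD : IsOpen D)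
    (hH : ContDiff ℝ ∞ H) (h0 : ∀ p ∈ D, H p ≠ 0) (h1 : ∀ p ∈ D, pd H du1 p ≠ 0)
    (h2 : ∀ p ∈ D, pd (pd H du1) du1 p ≠ 0)
    (hcomm : ∀ p ∈ D, lie (nabla3 H) (nabla1 H) p = K p • nabla2 H p)
    {p : ℝ × ℝ × ℝ} (hp : p ∈ D) : (H p - 1) * pd (pd H du1) dx p = 0 := by
  have dH : HasFDerivAt H (fderiv ℝ H p) p :=
    (hH.differentiable (by simp)).differentiableAt.hasFDerivAt
  have dH1 : HasFDerivAt (pd H du1) (fderiv ℝ (pd H du1) p) p :=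
    ((contDiff_pd hH du1).differentiable (by simp)).differentiableAt.hasFDerivAt
  have hu : HasFDerivAt (fun q : ℝ × ℝ × ℝ => q.2.2)
      ((ContinuousLinearMap.snd ℝ ℝ ℝ).comp (ContinuousLinearMap.snd ℝ ℝ (ℝ × ℝ))) p :=
    ((ContinuousLinearMap.snd ℝ ℝ ℝ).comp (ContinuousLinearMap.snd ℝ ℝ (ℝ × ℝ))).hasFDerivAt
  have e1 := h1 p hp
  have e2 := h2 p hp
  have e0 := h0 p hp
  have dn1 := ((contDiffOn_nabla1 hH h1).differentiableAt_of_isOpen hD hp).hasFDerivAt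
  have dn3 := ((contDiffOn_nabla3 hH h1 h2).differentiableAt_of_isOpen hD hp).hasFDerivAt
  have n1 : ∀ᶠ q in nhds p, (nabla1 H q).2.1 * pd H du1 q = q.2.2 * pd H du1 q - H q := by
    filter_upwards [hD.mem_nhds hp] with q hq
    exact div_mul_cancel₀ _ (h1 q hq)
  have n3 : ∀ᶠ q in nhds p, (nabla3 H q).2.1 * pd H du1 q = H q := by
    filter_upwards [hD.mem_nhds hp] with q hq
    exact div_mul_cancel₀ _ (h1 q hq)
  have k1 := ((dn1.snd.fst.mul dH1).congr_of_eventuallyEq (n1.mono fun _ h => h.symm)).unique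
    ((hu.mul dH1).sub dH)
  have k3 := ((dn3.snd.fst.mul dH1).congr_of_eventuallyEq (n3.mono fun _ h => h.symm)).unique dH
  have key := congrArg (fun v : ℝ × ℝ × ℝ => v.2.1) (hcomm p hp)
  have k1' := congrArg (fun L => L (nabla3 H p)) k1
  have k3' := congrArg (fun L => L (nabla1 H p)) k3
  simp [lie, nabla2] at key k1' k3'
  have comb : (nabla3 H p).2.2 * pd H du1 p + (p.2.2 - (nabla1 H p).2.1)
      * fderiv ℝ (pd H du1) p (nabla3 H p) - fderiv ℝ H p (nabla3 H p) - fderiv ℝ H p (nabla1 H p)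
      + (nabla3 H p).2.1 * fderiv ℝ (pd H du1) p (nabla1 H p) = 0 := by
    linear_combination pd H du1 p * key - k1' + k3'
  simp only [fderiv_eq_pd] at comb
  simp only [nabla1, nabla3] at comb
  rw [pd_comm hH du du1, pd_comm hH dx du1] at comb
  have h : (H p - 1) * pd (pd H du1) dx p * (H p / pd H du1 p) = 0 := by
    rw [← comb]
    field_simp
    ring
  exact (mul_eq_zero.1 h).resolve_right (div_ne_zero e0 e1)

/-- Along `∇₃ + ∇₁` the derivative of `H_{u₁}` is `H_x H_{u₁} + H_u`. -/
lemma fderiv_pd_nabla3_add_nabla1 {H : ℝ × ℝ × ℝ → ℝ} (hH : ContDiff ℝ ∞ H) {p : ℝ × ℝ × ℝ}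
    (h1 : pd H du1 p ≠ 0) (h2 : pd (pd H du1) du1 p ≠ 0)
    (hx : (H p - 1) * pd (pd H du1) dx p = 0) :
    fderiv ℝ (pd H du1) p (nabla3 H p + nabla1 H p) = pd H dx p * pd H du1 p + pd H du p := by
  rw [← add_zero (_ * _ + _), ← hx, fderiv_eq_pd]
  simp only [nabla1, nabla3, Prod.fst_add, Prod.snd_add]
  rw [pd_comm hH du du1, pd_comm hH dx du1]
  field_simp
  ring

/-- The bracket of related vector fields is the image of the bracket. -/
lemma lie_of_related {V W V' W' Φ : ℝ × ℝ × ℝ → ℝ × ℝ × ℝ} {p : ℝ × ℝ × ℝ}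
    (hΦ : ContDiff ℝ ∞ Φ)
    (dV : DifferentiableAt ℝ V p) (dW : DifferentiableAt ℝ W p)
    (dV' : DifferentiableAt ℝ V' (Φ p)) (dW' : DifferentiableAt ℝ W' (Φ p))
    (hV : ∀ᶠ q in nhds p, fderiv ℝ Φ q (V q) = V' (Φ q))
    (hW : ∀ᶠ q in nhds p, fderiv ℝ Φ q (W q) = W' (Φ q)) :
    lie V' W' (Φ p) = fderiv ℝ Φ p (lie V W p) := by
  have hd : HasFDerivAt (fderiv ℝ Φ) (fderiv ℝ (fderiv ℝ Φ) p) p :=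
    ((hΦ.fderiv_right (m := ∞) le_rfl).differentiable (by simp)).differentiableAt.hasFDerivAt
  have hs : IsSymmSndFDerivAt ℝ Φ p := hΦ.contDiffAt.isSymmSndFDerivAt
    (by simpa using WithTop.coe_le_coe.2 (le_top : (2 : ℕ∞) ≤ ⊤))
  have dΦ : HasFDerivAt Φ (fderiv ℝ Φ p) p :=
    (hΦ.differentiable (by simp)).differentiableAt.hasFDerivAt
  have kV := ((hd.clm_apply dV.hasFDerivAt).congr_of_eventuallyEq
    (hV.mono fun _ h => h.symm)).unique (dV'.hasFDerivAt.comp p dΦ)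
  have kW := ((hd.clm_apply dW.hasFDerivAt).congr_of_eventuallyEq
    (hW.mono fun _ h => h.symm)).unique (dW'.hasFDerivAt.comp p dΦ)
  have kV' := congrArg (fun L => L (W p)) kV
  have kW' := congrArg (fun L => L (V p)) kW
  simp only [add_apply, ContinuousLinearMap.comp_apply,
    ContinuousLinearMap.flip_apply] at kV' kW'
  rw [lie, lie, ← hV.self_of_nhds, ← hW.self_of_nhds, ← kV', ← kW', hs.eq (V p) (W p), map_sub]
  abel

/-- Invariant functions stay invariant when differentiated along related vector fields. -/
lemma vfD_of_related {V V' Φ : ℝ × ℝ × ℝ → ℝ × ℝ × ℝ} {I I' : ℝ × ℝ × ℝ → ℝ}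
    {D D' : Set (ℝ × ℝ × ℝ)} (hD : IsOpen D) (hD' : IsOpen D') (hmaps : Set.MapsTo Φ D D')
    (hΦ : ContDiff ℝ ∞ Φ) (hI' : ContDiffOn ℝ ∞ I' D')
    (hV : ∀ p ∈ D, fderiv ℝ Φ p (V p) = V' (Φ p)) (hI : ∀ p ∈ D, I' (Φ p) = I p) :
    ∀ p ∈ D, vfD V' I' (Φ p) = vfD V I p := by
  intro p hp
  have dI := (hI'.differentiableAt_of_isOpen hD' (hmaps hp)).hasFDerivAt.comp p
    (hΦ.differentiable (by simp)).differentiableAt.hasFDerivAt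
  have heq : I =ᶠ[nhds p] I' ∘ Φ := by
    filter_upwards [hD.mem_nhds hp] with q hq using (hI q hq).symm
  rw [vfD, vfD, (dI.congr_of_eventuallyEq heq).fderiv, ContinuousLinearMap.comp_apply, hV p hp]

section Prolongation

variable {F G : ℝ × ℝ × ℝ → ℝ} {X : ℝ → ℝ} {U : ℝ × ℝ → ℝ}

lemma contDiff_Ux (hU : ContDiff ℝ ∞ U) : ContDiff ℝ ∞ (Ux U) :=
  contDiff_fderiv_apply_const hU _

lemma contDiff_Uu (hU : ContDiff ℝ ∞ U) : ContDiff ℝ ∞ (Uu U) :=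
  contDiff_fderiv_apply_const hU _

lemma contDiff_Prol (hX : ContDiff ℝ ∞ X) (hU : ContDiff ℝ ∞ U) (hG : ContDiff ℝ ∞ G) :
    ContDiff ℝ ∞ (Prol X U G) := by
  have := contDiff_Ux hU
  have := contDiff_Uu hU
  unfold Prol
  fun_prop

lemma contDiff_deriv (hX : ContDiff ℝ ∞ X) : ContDiff ℝ ∞ (deriv X) :=
  (contDiff_infty_iff_deriv.1 hX).2

lemma hasFDerivAt_comp_xu {f : ℝ × ℝ → ℝ} (hf : ContDiff ℝ ∞ f) (p : ℝ × ℝ × ℝ) :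
    HasFDerivAt (fun q : ℝ × ℝ × ℝ => f (q.1, q.2.1))
      ((fderiv ℝ f (p.1, p.2.1)).comp ((ContinuousLinearMap.fst ℝ ℝ (ℝ × ℝ)).prod
        ((ContinuousLinearMap.fst ℝ ℝ ℝ).comp (ContinuousLinearMap.snd ℝ ℝ (ℝ × ℝ))))) p := by
  have h : HasFDerivAt f (fderiv ℝ f (p.1, p.2.1)) (p.1, p.2.1) :=
    (hf.differentiable (by simp)).differentiableAt.hasFDerivAt
  exact h.comp p (ContinuousLinearMap.hasFDerivAt ((ContinuousLinearMap.fst ℝ ℝ (ℝ × ℝ)).prod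
        ((ContinuousLinearMap.fst ℝ ℝ ℝ).comp (ContinuousLinearMap.snd ℝ ℝ (ℝ × ℝ)))))

lemma fderiv_comp_xu {f : ℝ × ℝ → ℝ} (hf : ContDiff ℝ ∞ f) (p v : ℝ × ℝ × ℝ) :
    fderiv ℝ (fun q : ℝ × ℝ × ℝ => f (q.1, q.2.1)) p v
      = v.1 * Ux f (p.1, p.2.1) + v.2.1 * Uu f (p.1, p.2.1) := by
  rw [(hasFDerivAt_comp_xu hf p).fderiv]
  have h : ((v.1, v.2.1) : ℝ × ℝ) = v.1 • (1, 0) + v.2.1 • (0, 1) := by ext <;> simp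
  change fderiv ℝ f (p.1, p.2.1) (v.1, v.2.1) = _
  rw [h, map_add, map_smul, map_smul]
  rfl

lemma Uu_Ux_eq (hU : ContDiff ℝ ∞ U) : Uu (Ux U) = Ux (Uu U) :=
  funext fun q => fderiv_fderiv_apply_comm hU q _ _

lemma fderiv_Prol (hX : ContDiff ℝ ∞ X) (hU : ContDiff ℝ ∞ U) (hG : ContDiff ℝ ∞ G)
    (p v : ℝ × ℝ × ℝ) :
    fderiv ℝ (Prol X U G) p v = (deriv X p.1 * v.1,
      v.1 * Ux U (p.1, p.2.1) + v.2.1 * Uu U (p.1, p.2.1),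
      (v.1 * Ux (Ux U) (p.1, p.2.1) + v.2.1 * Ux (Uu U) (p.1, p.2.1)) * G p
        + Ux U (p.1, p.2.1) * fderiv ℝ G p v
        + (v.1 * Ux (Uu U) (p.1, p.2.1) + v.2.1 * Uu (Uu U) (p.1, p.2.1)) * p.2.2
        + Uu U (p.1, p.2.1) * v.2.2) := by
  have cx := contDiff_Ux hU
  have cu := contDiff_Uu hU
  have dX : HasFDerivAt (fun q : ℝ × ℝ × ℝ => X q.1)
      (deriv X p.1 • ContinuousLinearMap.fst ℝ ℝ (ℝ × ℝ)) p :=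
    ((hX.differentiable (by simp)).differentiableAt.hasDerivAt).comp_hasFDerivAt p hasFDerivAt_fst
  have dU := (hasFDerivAt_comp_xu hU p).differentiableAt.hasFDerivAt
  have dUx := (hasFDerivAt_comp_xu cx p).differentiableAt.hasFDerivAt
  have dUu := (hasFDerivAt_comp_xu cu p).differentiableAt.hasFDerivAt
  have dG : HasFDerivAt G (fderiv ℝ G p) p :=
    (hG.differentiable (by simp)).differentiableAt.hasFDerivAt
  have h := dX.prodMk (dU.prodMk ((dUx.mul dG).add (dUu.mul (hasFDerivAt_snd.snd (x := p)))))
  have h' : HasFDerivAt (Prol X U G) _ p := h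
  rw [h'.fderiv, ← Uu_Ux_eq hU]
  simp [fderiv_comp_xu hU, fderiv_comp_xu cx, fderiv_comp_xu cu]
  rw [Uu_Ux_eq hU]
  ring

lemma fderiv_deriv_mul (hX : ContDiff ℝ ∞ X) {f : ℝ × ℝ × ℝ → ℝ} (hf : ContDiff ℝ ∞ f)
    (p v : ℝ × ℝ × ℝ) :
    fderiv ℝ (fun q : ℝ × ℝ × ℝ => deriv X q.1 * f q) p v
      = deriv (deriv X) p.1 * v.1 * f p + deriv X p.1 * fderiv ℝ f p v := by
  have dX : HasFDerivAt (fun q : ℝ × ℝ × ℝ => deriv X q.1)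
      (deriv (deriv X) p.1 • ContinuousLinearMap.fst ℝ ℝ (ℝ × ℝ)) p :=
    (((contDiff_deriv hX).differentiable (by simp)).differentiableAt.hasDerivAt).comp_hasFDerivAt p
      hasFDerivAt_fst
  have df : HasFDerivAt f (fderiv ℝ f p) p :=
    (hf.differentiable (by simp)).differentiableAt.hasFDerivAt
  have h : HasFDerivAt (fun q : ℝ × ℝ × ℝ => deriv X q.1 * f q) _ p := dX.mul df
  rw [h.fderiv]
  simp
  ring

lemma fderiv_Wfun (hU : ContDiff ℝ ∞ U) (hG : ContDiff ℝ ∞ G) (p v : ℝ × ℝ × ℝ) :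
    fderiv ℝ (Wfun U G) p v
      = (v.1 * Ux (Ux U) (p.1, p.2.1) + v.2.1 * Ux (Uu U) (p.1, p.2.1)) * pd G du1 p
        + Ux U (p.1, p.2.1) * fderiv ℝ (pd G du1) p v
        + (v.1 * Ux (Uu U) (p.1, p.2.1) + v.2.1 * Uu (Uu U) (p.1, p.2.1)) := by
  have cx := contDiff_Ux hU
  have cu := contDiff_Uu hU
  have dUx := (hasFDerivAt_comp_xu cx p).differentiableAt.hasFDerivAt
  have dUu := (hasFDerivAt_comp_xu cu p).differentiableAt.hasFDerivAt
  have dG : HasFDerivAt (pd G du1) (fderiv ℝ (pd G du1) p) p :=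
    ((contDiff_pd hG du1).differentiable (by simp)).differentiableAt.hasFDerivAt
  have h : HasFDerivAt (Wfun U G) _ p := (dUx.mul dG).add dUu
  rw [h.fderiv]
  simp [fderiv_comp_xu cx, fderiv_comp_xu cu]
  rw [Uu_Ux_eq hU]
  ring

variable {D : Set (ℝ × ℝ × ℝ)} {p : ℝ × ℝ × ℝ}

/-- The relation between `F` and `G`, differentiated once. -/
lemma Relates.fderiv_eq (hrel : Relates X U G F D) (hD : IsOpen D) (hp : p ∈ D)
    (hX : ContDiff ℝ ∞ X) (hU : ContDiff ℝ ∞ U) (hF : ContDiff ℝ ∞ F) (hG : ContDiff ℝ ∞ G)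
    (v : ℝ × ℝ × ℝ) :
    deriv (deriv X) p.1 * v.1 * G p + deriv X p.1 * fderiv ℝ G p v
      = fderiv ℝ F (Prol X U G p) (fderiv ℝ (Prol X U G) p v) := by
  have dF : HasFDerivAt F (fderiv ℝ F (Prol X U G p)) (Prol X U G p) :=
    (hF.differentiable (by simp)).differentiableAt.hasFDerivAt
  have dP := ((contDiff_Prol hX hU hG).differentiable (by simp) p).hasFDerivAt
  have heq : (fun q : ℝ × ℝ × ℝ => deriv X q.1 * G q) =ᶠ[nhds p] F ∘ Prol X U G := by
    filter_upwards [hD.mem_nhds hp] with q hq using hrel q hq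
  rw [← fderiv_deriv_mul hX hG, ((dF.comp p dP).congr_of_eventuallyEq heq).fderiv,
    ContinuousLinearMap.comp_apply]

lemma Relates.pd_du1_eq (hrel : Relates X U G F D) (hD : IsOpen D) (hp : p ∈ D)
    (hX : ContDiff ℝ ∞ X) (hU : ContDiff ℝ ∞ U) (hF : ContDiff ℝ ∞ F) (hG : ContDiff ℝ ∞ G) :
    deriv X p.1 * pd G du1 p = Wfun U G p * pd F du1 (Prol X U G p) := by
  have h := hrel.fderiv_eq hD hp hX hU hF hG du1
  rw [fderiv_Prol hX hU hG, fderiv_eq_pd F] at h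
  simp only [du1, Wfun, pd] at h ⊢
  linear_combination h

lemma Relates.pd_du_eq (hrel : Relates X U G F D) (hD : IsOpen D) (hp : p ∈ D)
    (hX : ContDiff ℝ ∞ X) (hU : ContDiff ℝ ∞ U) (hF : ContDiff ℝ ∞ F) (hG : ContDiff ℝ ∞ G) :
    deriv X p.1 * pd G du p = Uu U (p.1, p.2.1) * pd F du (Prol X U G p)
      + (Ux (Uu U) (p.1, p.2.1) * G p + Ux U (p.1, p.2.1) * pd G du p
        + Uu (Uu U) (p.1, p.2.1) * p.2.2) * pd F du1 (Prol X U G p) := by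
  have h := hrel.fderiv_eq hD hp hX hU hF hG du
  rw [fderiv_Prol hX hU hG, fderiv_eq_pd F] at h
  simp only [du, pd] at h ⊢
  linear_combination h

lemma Relates.pd_dx_eq (hrel : Relates X U G F D) (hD : IsOpen D) (hp : p ∈ D)
    (hX : ContDiff ℝ ∞ X) (hU : ContDiff ℝ ∞ U) (hF : ContDiff ℝ ∞ F) (hG : ContDiff ℝ ∞ G) :
    deriv (deriv X) p.1 * G p + deriv X p.1 * pd G dx p
      = deriv X p.1 * pd F dx (Prol X U G p) + Ux U (p.1, p.2.1) * pd F du (Prol X U G p)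
      + (Ux (Ux U) (p.1, p.2.1) * G p + Ux U (p.1, p.2.1) * pd G dx p
        + Ux (Uu U) (p.1, p.2.1) * p.2.2) * pd F du1 (Prol X U G p) := by
  have h := hrel.fderiv_eq hD hp hX hU hF hG dx
  rw [fderiv_Prol hX hU hG, fderiv_eq_pd F] at h
  simp only [dx, pd] at h ⊢
  linear_combination h

/-- The relation between `F_{u₁}` and `G_{u₁}`, differentiated once. -/
lemma Relates.fderiv_pd_du1_eq (hrel : Relates X U G F D) (hD : IsOpen D) (hp : p ∈ D)
    (hX : ContDiff ℝ ∞ X) (hU : ContDiff ℝ ∞ U) (hF : ContDiff ℝ ∞ F) (hG : ContDiff ℝ ∞ G)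
    (v : ℝ × ℝ × ℝ) :
    deriv (deriv X) p.1 * v.1 * pd G du1 p + deriv X p.1 * fderiv ℝ (pd G du1) p v
      = fderiv ℝ (Wfun U G) p v * pd F du1 (Prol X U G p)
        + Wfun U G p * fderiv ℝ (pd F du1) (Prol X U G p) (fderiv ℝ (Prol X U G) p v) := by
  have dF : HasFDerivAt (pd F du1) (fderiv ℝ (pd F du1) (Prol X U G p)) (Prol X U G p) :=
    ((contDiff_pd hF du1).differentiable (by simp)).differentiableAt.hasFDerivAt
  have dP := ((contDiff_Prol hX hU hG).differentiable (by simp) p).hasFDerivAt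
  have cW : ContDiff ℝ ∞ (Wfun U G) := by
    have := contDiff_Ux hU
    have := contDiff_Uu hU
    have := contDiff_pd hG du1
    unfold Wfun
    fun_prop
  have dW := (cW.differentiable (by simp) p).hasFDerivAt
  have heq : (fun q : ℝ × ℝ × ℝ => deriv X q.1 * pd G du1 q)
      =ᶠ[nhds p] Wfun U G * (pd F du1 ∘ Prol X U G) := by
    filter_upwards [hD.mem_nhds hp] with q hq using hrel.pd_du1_eq hD hq hX hU hF hG
  rw [← fderiv_deriv_mul hX (contDiff_pd hG du1),
    ((dW.mul (dF.comp p dP)).congr_of_eventuallyEq heq).fderiv]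
  simp
  ring

lemma Relates.pd_du1_du1_eq (hrel : Relates X U G F D) (hD : IsOpen D) (hp : p ∈ D)
    (hX : ContDiff ℝ ∞ X) (hU : ContDiff ℝ ∞ U) (hF : ContDiff ℝ ∞ F) (hG : ContDiff ℝ ∞ G) :
    deriv X p.1 * pd (pd G du1) du1 p
      = Ux U (p.1, p.2.1) * pd (pd G du1) du1 p * pd F du1 (Prol X U G p)
        + Wfun U G p ^ 2 * pd (pd F du1) du1 (Prol X U G p) := by
  have h := hrel.fderiv_pd_du1_eq hD hp hX hU hF hG du1
  rw [fderiv_Wfun hU hG, fderiv_Prol hX hU hG, fderiv_eq_pd (pd F du1)] at h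
  change _ * _ * _ + _ * pd (pd G du1) du1 p = (_ + _ * pd (pd G du1) du1 p + _) * _ + _ *
    (_ + _ + (_ + Ux U (p.1, p.2.1) * pd G du1 p + _ + _) * _) at h
  rw [show du1 = (0, 0, 1) from rfl] at h ⊢
  simp only [Wfun] at h ⊢
  rw [show du1 = (0, 0, 1) from rfl] at h ⊢
  linear_combination h

lemma Relates.Jinv_eq (hrel : Relates X U G F D) (hD : IsOpen D) (hp : p ∈ D)
    (hX : ContDiff ℝ ∞ X) (hU : ContDiff ℝ ∞ U) (hF : ContDiff ℝ ∞ F) (hG : ContDiff ℝ ∞ G)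
    (hX' : deriv X p.1 ≠ 0) (hUu : Uu U (p.1, p.2.1) ≠ 0) (h1 : pd G du1 p ≠ 0)
    (h3 : p.2.2 * pd G du1 p - G p ≠ 0) :
    Jinv F (Prol X U G p) = Jinv G p := by
  have e0 : deriv X p.1 * G p = F (Prol X U G p) := hrel p hp
  have e1 := hrel.pd_du1_eq hD hp hX hU hF hG
  have e2 := hrel.pd_du1_du1_eq hD hp hX hU hF hG
  have hW : Wfun U G p ≠ 0 := left_ne_zero_of_mul (e1 ▸ mul_ne_zero hX' h1)
  have f1 : pd F du1 (Prol X U G p) = deriv X p.1 * pd G du1 p / Wfun U G p := by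
    rw [e1]; field_simp
  have f2 : pd (pd F du1) du1 (Prol X U G p)
      = deriv X p.1 * Uu U (p.1, p.2.1) * pd (pd G du1) du1 p / Wfun U G p ^ 3 := by
    rw [eq_div_iff (pow_ne_zero _ hW)]
    have hW' : Wfun U G p = Ux U (p.1, p.2.1) * pd G du1 p + Uu U (p.1, p.2.1) := rfl
    linear_combination (-Wfun U G p) * e2 + Ux U (p.1, p.2.1) * pd (pd G du1) du1 p * e1
      + deriv X p.1 * pd (pd G du1) du1 p * hW'
  have f3 : (Prol X U G p).2.2 * pd F du1 (Prol X U G p) - F (Prol X U G p)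
      = deriv X p.1 * Uu U (p.1, p.2.1) * (p.2.2 * pd G du1 p - G p) / Wfun U G p := by
    rw [f1, ← e0, eq_div_iff hW, sub_mul, mul_assoc _ (_ / _), div_mul_cancel₀ _ hW]
    simp only [Prol, Wfun]
    ring
  rw [Jinv, Jinv, f3, f2, f1, ← e0]
  field_simp

lemma Relates.nabla2_eq (hrel : Relates X U G F D) (hD : IsOpen D) (hp : p ∈ D)
    (hX : ContDiff ℝ ∞ X) (hU : ContDiff ℝ ∞ U) (hF : ContDiff ℝ ∞ F) (hG : ContDiff ℝ ∞ G)
    (hX' : deriv X p.1 ≠ 0) (h1 : pd G du1 p ≠ 0) :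
    fderiv ℝ (Prol X U G) p (nabla2 G p) = nabla2 F (Prol X U G p) := by
  have e0 : deriv X p.1 * G p = F (Prol X U G p) := hrel p hp
  have e1 := hrel.pd_du1_eq hD hp hX hU hF hG
  have hWF := e1 ▸ mul_ne_zero hX' h1
  have hW : Wfun U G p ≠ 0 := left_ne_zero_of_mul hWF
  have hF1 := right_ne_zero_of_mul hWF
  rw [fderiv_Prol hX hU hG, fderiv_eq_pd G]
  simp only [nabla2, Prod.mk.injEq]
  refine ⟨by simp, by simp, ?_⟩
  rw [← e0, eq_div_iff hF1]
  field_simp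
  simp only [Wfun] at e1
  linear_combination (-G p) * e1

lemma Relates.nabla1_eq (hrel : Relates X U G F D) (hD : IsOpen D) (hp : p ∈ D)
    (hX : ContDiff ℝ ∞ X) (hU : ContDiff ℝ ∞ U) (hF : ContDiff ℝ ∞ F) (hG : ContDiff ℝ ∞ G)
    (hX' : deriv X p.1 ≠ 0) (h1 : pd G du1 p ≠ 0) :
    fderiv ℝ (Prol X U G) p (nabla1 G p) = nabla1 F (Prol X U G p) := by
  have e0 : deriv X p.1 * G p = F (Prol X U G p) := hrel p hp
  have e1 := hrel.pd_du1_eq hD hp hX hU hF hG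
  have eu := hrel.pd_du_eq hD hp hX hU hF hG
  have hWF := e1 ▸ mul_ne_zero hX' h1
  have hF1 := right_ne_zero_of_mul hWF
  have f2 : (p.2.2 * pd G du1 p - G p) / pd G du1 p * Uu U (p.1, p.2.1)
      = ((Prol X U G p).2.2 * pd F du1 (Prol X U G p) - F (Prol X U G p))
        / pd F du1 (Prol X U G p) := by
    rw [← e0, eq_div_iff hF1]
    field_simp
    simp only [Wfun, Prol] at e1 ⊢
    linear_combination G p * e1
  have f3 : (F (Prol X U G p) - (Prol X U G p).2.2 * pd F du1 (Prol X U G p))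
      * pd F du (Prol X U G p) / pd F du1 (Prol X U G p) ^ 2
      = - ((p.2.2 * pd G du1 p - G p) / pd G du1 p * Uu U (p.1, p.2.1))
        * pd F du (Prol X U G p) / pd F du1 (Prol X U G p) := by
    rw [f2]
    field_simp
    ring
  rw [fderiv_Prol hX hU hG, fderiv_eq_pd G]
  simp only [nabla1, Prod.mk.injEq]
  refine ⟨by simp, by rw [← f2]; simp, ?_⟩
  rw [f3, eq_div_iff hF1]
  field_simp
  simp only [Wfun] at e1
  linear_combination (p.2.2 * pd G du1 p - G p) * (pd G du p * e1 - pd G du1 p * eu)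

lemma Relates.nabla3_eq (hrel : Relates X U G F D) (hD : IsOpen D) (hp : p ∈ D)
    (hX : ContDiff ℝ ∞ X) (hU : ContDiff ℝ ∞ U) (hF : ContDiff ℝ ∞ F) (hG : ContDiff ℝ ∞ G)
    (hX' : deriv X p.1 ≠ 0) (h1 : pd G du1 p ≠ 0) (h2 : pd (pd G du1) du1 p ≠ 0)
    (hF2 : pd (pd F du1) du1 (Prol X U G p) ≠ 0)
    (hGx : (G p - 1) * pd (pd G du1) dx p = 0)
    (hFx : (F (Prol X U G p) - 1) * pd (pd F du1) dx (Prol X U G p) = 0) :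
    fderiv ℝ (Prol X U G) p (nabla3 G p) = nabla3 F (Prol X U G p) := by
  have e0 : deriv X p.1 * G p = F (Prol X U G p) := hrel p hp
  have e1 := hrel.pd_du1_eq hD hp hX hU hF hG
  have eu := hrel.pd_du_eq hD hp hX hU hF hG
  have ex := hrel.pd_dx_eq hD hp hX hU hF hG
  have hWF := e1 ▸ mul_ne_zero hX' h1
  have hW : Wfun U G p ≠ 0 := left_ne_zero_of_mul hWF
  have hF1 := right_ne_zero_of_mul hWF
  set P := Prol X U G p with hP
  suffices h : fderiv ℝ (Prol X U G) p (nabla3 G p + nabla1 G p) = nabla3 F P + nabla1 F P by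
    rw [map_add, hrel.nabla1_eq hD hp hX hU hF hG hX' h1] at h
    exact add_right_cancel h
  have zG := fderiv_pd_nabla3_add_nabla1 hG h1 h2 hGx
  have zF := fderiv_pd_nabla3_add_nabla1 hF hF1 hF2 hFx
  have z1 (H : ℝ × ℝ × ℝ → ℝ) (q : ℝ × ℝ × ℝ) : (nabla3 H q + nabla1 H q).1 = H q := by
    simp [nabla1, nabla3]
  have z2 {H : ℝ × ℝ × ℝ → ℝ} {q : ℝ × ℝ × ℝ} (h : pd H du1 q ≠ 0) :
      (nabla3 H q + nabla1 H q).2.1 = q.2.2 := by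
    simp only [nabla1, nabla3, Prod.fst_add, Prod.snd_add]
    field_simp
    ring
  have g1 := z1 G p
  have g2 := z2 h1
  have k1 := z1 F P
  have k2 := z2 hF1
  set Z := nabla3 G p + nabla1 G p
  set Z' := nabla3 F P + nabla1 F P
  have key := hrel.fderiv_pd_du1_eq hD hp hX hU hF hG Z
  have c1 : (fderiv ℝ (Prol X U G) p Z).1 = Z'.1 := by
    rw [fderiv_Prol hX hU hG, k1, ← e0, g1]
  have c2 : (fderiv ℝ (Prol X U G) p Z).2.1 = Z'.2.1 := by
    rw [fderiv_Prol hX hU hG, k2, g1, g2]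
    simp only [hP, Prol]
    ring
  have c3 : Wfun U G p * fderiv ℝ (pd F du1) P (fderiv ℝ (Prol X U G) p Z)
      = Wfun U G p * fderiv ℝ (pd F du1) P Z' := by
    rw [zF]
    rw [fderiv_Wfun hU hG, zG, g1, g2] at key
    simp only [Wfun] at e1 key ⊢
    linear_combination -key + pd G du1 p * ex + eu + pd F dx P * e1
  have c4 := mul_left_cancel₀ hW c3
  rw [fderiv_eq_pd, fderiv_eq_pd _ _ Z', c1, c2] at c4
  exact Prod.ext c1 (Prod.ext c2 (mul_right_cancel₀ hF2 (add_left_cancel c4)))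

end Prolongation

/-- if the feedback transformation `(X,U)` relates `G` to `F` on
`D_G` and its prolongation `Φ̃` is a diffeomorphism from `D_G` onto `D_F`
(with the stated regularity on both sides), then `σ_F ∘ Φ̃ = σ_G` on `D_G` and
hence `Σ_F = σ_F(D_F) = σ_G(D_G) = Σ_G`: the image `Σ_F ⊆ ℝ¹⁴` depends only on
the feedback equivalence class of `F`. -/
theorem sigma_image_feedback_invariant
    (F G : ℝ × ℝ × ℝ → ℝ) (X : ℝ → ℝ) (U : ℝ × ℝ → ℝ)
    (hF : ContDiff ℝ (⊤ : ℕ∞) F) (hG : ContDiff ℝ (⊤ : ℕ∞) G)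
    (hX : ContDiff ℝ (⊤ : ℕ∞) X) (hU : ContDiff ℝ (⊤ : ℕ∞) U)
    (hX' : ∀ x, deriv X x ≠ 0) (hUu : ∀ q, Uu U q ≠ 0)
    (DG DF : Set (ℝ × ℝ × ℝ)) (hDG : IsOpen DG) (hDF : IsOpen DF)
    (hG0 : ∀ p ∈ DG, G p ≠ 0)
    (hG1 : ∀ p ∈ DG, pd G du1 p ≠ 0)
    (hG2 : ∀ p ∈ DG, pd (pd G du1) du1 p ≠ 0)
    (hG3 : ∀ p ∈ DG, p.2.2 * pd G du1 p - G p ≠ 0)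
    (hF0 : ∀ q ∈ DF, F q ≠ 0)
    (hF1 : ∀ q ∈ DF, pd F du1 q ≠ 0)
    (hF2 : ∀ q ∈ DF, pd (pd F du1) du1 q ≠ 0)
    (hF3 : ∀ q ∈ DF, q.2.2 * pd F du1 q - F q ≠ 0)
    (KF KG : ℝ × ℝ × ℝ → ℝ)
    (hKF : ContDiffOn ℝ (⊤ : ℕ∞) KF DF) (hKG : ContDiffOn ℝ (⊤ : ℕ∞) KG DG)
    (hcommF : ∀ q ∈ DF, lie (nabla3 F) (nabla1 F) q = KF q • nabla2 F q)
    (hcommG : ∀ p ∈ DG, lie (nabla3 G) (nabla1 G) p = KG p • nabla2 G p)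
    (hrel : Relates X U G F DG)
    (hbij : Set.BijOn (Prol X U G) DG DF)
    (hdiffeo : ∃ Ψ : ℝ × ℝ × ℝ → ℝ × ℝ × ℝ, ContDiffOn ℝ (⊤ : ℕ∞) Ψ DF ∧
      Set.EqOn (Ψ ∘ Prol X U G) id DG) :
    (∀ p ∈ DG, sigmaMap F KF (Prol X U G p) = sigmaMap G KG p) ∧
    sigmaMap F KF '' DF = sigmaMap G KG '' DG := by
  have hm := hbij.mapsTo
  have hΦ := contDiff_Prol hX hU hG
  have r1 : ∀ p ∈ DG, fderiv ℝ (Prol X U G) p (nabla1 G p) = nabla1 F (Prol X U G p) :=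
    fun p hp => hrel.nabla1_eq hDG hp hX hU hF hG (hX' _) (hG1 p hp)
  have r2 : ∀ p ∈ DG, fderiv ℝ (Prol X U G) p (nabla2 G p) = nabla2 F (Prol X U G p) :=
    fun p hp => hrel.nabla2_eq hDG hp hX hU hF hG (hX' _) (hG1 p hp)
  have r3 : ∀ p ∈ DG, fderiv ℝ (Prol X U G) p (nabla3 G p) = nabla3 F (Prol X U G p) :=
    fun p hp => hrel.nabla3_eq hDG hp hX hU hF hG (hX' _) (hG1 p hp) (hG2 p hp)
      (hF2 _ (hm hp)) (sub_one_mul_pd_eq_zero hDG hG hG0 hG1 hG2 hcommG hp)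
      (sub_one_mul_pd_eq_zero hDF hF hF0 hF1 hF2 hcommF (hm hp))
  have sF1 := contDiffOn_nabla1 hF hF1
  have sF2 := contDiffOn_nabla2 hF hF1
  have sF3 := contDiffOn_nabla3 hF hF1 hF2
  have sJ := contDiffOn_Jinv hF hF1 hF3
  have iJ : ∀ p ∈ DG, Jinv F (Prol X U G p) = Jinv G p := fun p hp =>
    hrel.Jinv_eq hDG hp hX hU hF hG (hX' _) (hUu _) (hG1 p hp) (hG3 p hp)
  have iK : ∀ p ∈ DG, KF (Prol X U G p) = KG p := by
    intro p hp
    have h := lie_of_related (p := p) hΦ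
      ((contDiffOn_nabla3 hG hG1 hG2).differentiableAt_of_isOpen hDG hp)
      ((contDiffOn_nabla1 hG hG1).differentiableAt_of_isOpen hDG hp)
      (sF3.differentiableAt_of_isOpen hDF (hm hp)) (sF1.differentiableAt_of_isOpen hDF (hm hp))
      (Filter.eventually_of_mem (hDG.mem_nhds hp) r3)
      (Filter.eventually_of_mem (hDG.mem_nhds hp) r1)
    rw [hcommF _ (hm hp), hcommG p hp, map_smul, r2 p hp] at h
    have h' := congrArg (fun v : ℝ × ℝ × ℝ => v.2.2) h
    exact mul_right_cancel₀ (div_ne_zero (hF0 _ (hm hp)) (hF1 _ (hm hp))) h'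
  have step {V V' : ℝ × ℝ × ℝ → ℝ × ℝ × ℝ} {I I' : ℝ × ℝ × ℝ → ℝ}
      (hI' : ContDiffOn ℝ ∞ I' DF)
      (hV : ∀ p ∈ DG, fderiv ℝ (Prol X U G) p (V p) = V' (Prol X U G p))
      (hI : ∀ p ∈ DG, I' (Prol X U G p) = I p) :
      ∀ p ∈ DG, vfD V' I' (Prol X U G p) = vfD V I p :=
    vfD_of_related hDG hDF hm hΦ hI' hV hI
  have j1 := step sJ r1 iJ
  have j2 := step sJ r2 iJ
  have j3 := step sJ r3 iJ
  have s1 := contDiffOn_vfD hDF sF1 sJ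
  have s2 := contDiffOn_vfD hDF sF2 sJ
  have s3 := contDiffOn_vfD hDF sF3 sJ
  have main : ∀ p ∈ DG, sigmaMap F KF (Prol X U G p) = sigmaMap G KG p := by
    intro p hp
    rw [sigmaMap, sigmaMap, iJ p hp, iK p hp, j1 p hp, j2 p hp, j3 p hp, step s1 r1 j1 p hp,
      step s2 r1 j2 p hp, step s3 r1 j3 p hp, step s2 r2 j2 p hp, step s3 r2 j3 p hp,
      step s3 r3 j3 p hp, step hKF r1 iK p hp, step hKF r2 iK p hp, step hKF r3 iK p hp]
  refine ⟨main, ?_⟩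
  rw [← hbij.image_eq, Set.image_image]
  exact Set.image_congr main
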